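/- Set β₁ = αβα⁻¹ and γ₁ = γ. The assignment α ↦ σ₁, ᾱ ↦ σ₁, β ↦ σ₂, γ ↦ σ₂⁻¹σ₁σ₂, γ̄ ↦ σ₂⁻¹σ₁σ₂ induces group isomorphisms G₀/⟪β₁γ₁β₁⁻¹γ₁⁻¹⟫ ≅ B₃/⟪(σ₁σ₂σ₁)²⟫ and, for each m ∈ {0, 1, 2}, G_m/⟪β₁γ₁⁻¹⟫ ≅ B₃/⟪(σ₁σ₂σ₁)²⟫, which is isomorphic to the free product (ℤ/2) * (ℤ/3). Here ⟪·⟫ denotes the normal closure. -/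

import Mathlib

namespace Sextics

/-! Generators of the free group on five letters: `0 ↦ α`, `1 ↦ ᾱ`, `2 ↦ β`, `3 ↦ γ`,
`4 ↦ γ̄`. -/

abbrev F5 := FreeGroup (Fin 5)

def fa : F5 := FreeGroup.of 0
def fa' : F5 := FreeGroup.of 1
def fb : F5 := FreeGroup.of 2
def fc : F5 := FreeGroup.of 3
def fc' : F5 := FreeGroup.of 4

/-- Relators of the group `G̃`: the braid relations `αβα = βαβ`, `ᾱβᾱ = βᾱβ`,
`γβγ = βγβ`, `γ̄βγ̄ = βγ̄β` and the relation at infinity `βγαβγ̄ᾱ = 1`. -/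
def relsT : Set F5 :=
  {fa * fb * fa * (fb * fa * fb)⁻¹, fa' * fb * fa' * (fb * fa' * fb)⁻¹,
   fc * fb * fc * (fb * fc * fb)⁻¹, fc' * fb * fc' * (fb * fc' * fb)⁻¹,
   fb * fc * fa * fb * fc' * fa'}

/-- Relators of `G₁`: those of `G̃` together with `αγα = γαγ`, `ᾱγ̄ᾱ = γ̄ᾱγ̄`,
`γαγ̄ = γ̄ᾱγ`, `γγ̄ = γ̄γ`. -/
def rels1 : Set F5 :=
  relsT ∪
    {fa * fc * fa * (fc * fa * fc)⁻¹, fa' * fc' * fa' * (fc' * fa' * fc')⁻¹,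
     fc * fa * fc' * (fc' * fa' * fc)⁻¹, fc * fc' * (fc' * fc)⁻¹}

/-- Relators of `G₂`: those of `G̃` together with `ᾱγα = αγ̄ᾱ`, `αγ̄ᾱ = γαγ̄`,
`γαγ̄ = γ̄ᾱγ`. -/
def rels2 : Set F5 :=
  relsT ∪
    {fa' * fc * fa * (fa * fc' * fa')⁻¹, fa * fc' * fa' * (fc * fa * fc')⁻¹,
     fc * fa * fc' * (fc' * fa' * fc)⁻¹}

abbrev G1 := PresentedGroup rels1
abbrev G2 := PresentedGroup rels2

def a1 : G1 := PresentedGroup.of 0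
def a1' : G1 := PresentedGroup.of 1
def b1 : G1 := PresentedGroup.of 2
def c1 : G1 := PresentedGroup.of 3
def c1' : G1 := PresentedGroup.of 4

def a2 : G2 := PresentedGroup.of 0
def a2' : G2 := PresentedGroup.of 1
def b2 : G2 := PresentedGroup.of 2
def c2 : G2 := PresentedGroup.of 3
def c2' : G2 := PresentedGroup.of 4

/-- Relators of `G₀ = ⟨α, β, γ | αβα = βαβ, βγβ = γβγ, γαγ = αγα, (αβγ)² = 1⟩`
(generators `0 ↦ α`, `1 ↦ β`, `2 ↦ γ`). -/
def rels0 : Set (FreeGroup (Fin 3)) :=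
  {FreeGroup.of 0 * FreeGroup.of 1 * FreeGroup.of 0 *
      (FreeGroup.of 1 * FreeGroup.of 0 * FreeGroup.of 1)⁻¹,
   FreeGroup.of 1 * FreeGroup.of 2 * FreeGroup.of 1 *
      (FreeGroup.of 2 * FreeGroup.of 1 * FreeGroup.of 2)⁻¹,
   FreeGroup.of 2 * FreeGroup.of 0 * FreeGroup.of 2 *
      (FreeGroup.of 0 * FreeGroup.of 2 * FreeGroup.of 0)⁻¹,
   (FreeGroup.of 0 * FreeGroup.of 1 * FreeGroup.of 2) ^ 2}

abbrev G0 := PresentedGroup rels0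

def a0 : G0 := PresentedGroup.of 0
def b0 : G0 := PresentedGroup.of 1
def c0 : G0 := PresentedGroup.of 2

/-- The braid group `B₃ = ⟨σ₁, σ₂ | σ₁σ₂σ₁ = σ₂σ₁σ₂⟩`. -/
def relsB3 : Set (FreeGroup (Fin 2)) :=
  {FreeGroup.of 0 * FreeGroup.of 1 * FreeGroup.of 0 *
      (FreeGroup.of 1 * FreeGroup.of 0 * FreeGroup.of 1)⁻¹}

abbrev B3 := PresentedGroup relsB3

def σ1 : B3 := PresentedGroup.of 0
def σ2 : B3 := PresentedGroup.of 1

/-- The quotient `B₃/⟪(σ₁σ₂σ₁)²⟫`. -/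
abbrev Q3 := B3 ⧸ Subgroup.normalClosure ({(σ1 * σ2 * σ1) ^ 2} : Set B3)

def q1 : Q3 := QuotientGroup.mk σ1
def q2 : Q3 := QuotientGroup.mk σ2

end Sextics

namespace Sextics

section Braid

variable {G : Type*} [Group G] {a b c : G}

lemma conj_eq_of_braid (h : a * b * a = b * a * b) : a * b * a⁻¹ = b⁻¹ * a * b := by
  rw [mul_inv_eq_iff_eq_mul, mul_assoc, mul_assoc, eq_inv_mul_iff_mul_eq]
  simpa only [mul_assoc] using h.symm

lemma braid_conj_left (h : a * b * a = b * a * b) :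
    a * (a * b * a⁻¹) * a = (a * b * a⁻¹) * a * (a * b * a⁻¹) := by
  have : (a * b * a⁻¹) * a * (a * b * a⁻¹) = a * (b * a * b) * a⁻¹ := by group
  rw [this, ← h]
  group

lemma braid_conj_right (h : a * b * a = b * a * b) :
    b * (a * b * a⁻¹) * b = (a * b * a⁻¹) * b * (a * b * a⁻¹) := by
  rw [conj_eq_of_braid h]
  have : (b⁻¹ * a * b) * b * (b⁻¹ * a * b) = b⁻¹ * (a * b * a) * b := by group
  rw [this, h]
  group

lemma commute_braid_sq (h : a * b * a = b * a * b) :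
    Commute ((a * b * a) * (a * b * a)) a ∧ Commute ((a * b * a) * (a * b * a)) b := by
  have hab : SemiconjBy (a * b * a) a b := by
    change a * b * a * a = b * (a * b * a)
    rw [h]
    rw [mul_assoc, mul_assoc, ← mul_assoc a b a, h]
  have hba : SemiconjBy (a * b * a) b a := by
    change a * b * a * b = a * (a * b * a)
    nth_rewrite 2 [h]
    simp only [mul_assoc]
  exact ⟨hba.mul_left hab, hab.mul_left hba⟩

/-- If `b, a, c` satisfy the relations of the standard generators of the braid group `B₄`, then
`bac` conjugates `b` to `a` and `a` to `c`. -/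
lemma eq_of_braid_of_sq_eq_one (hba : b * a * b = a * b * a) (hac : a * c * a = c * a * c)
    (hbc : b * c = c * b) (hsq : (b * a * c) ^ 2 = 1) : b = c := by
  have h₁ : SemiconjBy (b * a * c) b a := by
    change b * a * c * b = a * (b * a * c)
    rw [mul_assoc, ← hbc, ← mul_assoc, hba]
    simp only [mul_assoc]
  have h₂ : SemiconjBy (b * a * c) a c := by
    change b * a * c * a = c * (b * a * c)
    rw [mul_assoc b, mul_assoc b, hac, mul_assoc c, ← mul_assoc, hbc]
    simp only [mul_assoc]
  have h₃ : SemiconjBy ((b * a * c) ^ 2) b c := by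
    rw [pow_two]
    exact h₂.mul_left h₁
  rw [hsq] at h₃
  simpa [SemiconjBy] using h₃

lemma braid_sq_of_conj (hsq : (a * b * (b⁻¹ * a * b)) ^ 2 = 1) : (a * b * a) ^ 2 = 1 := by
  have : (a * b * a) ^ 2 = a⁻¹ * (a * b * (b⁻¹ * a * b)) ^ 2 * a := by
    simp only [pow_two]
    group
  rw [this, hsq]
  group

/-- The consequences of the relations common to `G₁` and `G₂` together with `β₁ = γ₁`. -/
lemma collapse_of_conj_eq {a' c' : G} (h : a * b * a = b * a * b)
    (hc' : c' * b * c' = b * c' * b) (hinf : b * c * a * b * c' * a' = 1)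
    (hsymm : c * a * c' = c' * a' * c) (hc : a * b * a⁻¹ = c) :
    a' = a ∧ c' = c ∧ (a * b * a) ^ 2 = 1 := by
  have hcbc := braid_conj_right h
  rw [hc] at hcbc
  have hbc : c = b⁻¹ * a * b := by rw [← hc, conj_eq_of_braid h]
  obtain ⟨hza, hzb⟩ := commute_braid_sq h
  set z := (a * b * a) * (a * b * a) with hz
  have hz3 : z = (a * b) ^ 3 := by
    rw [hz]
    nth_rewrite 2 [h]
    simp only [pow_succ, pow_zero, one_mul, mul_assoc]
  have hzc : Commute z c := by
    rw [← hc]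
    exact (hza.mul_right hzb).mul_right hza.inv_right
  have hprod : c' * a' = ((a * b) ^ 2)⁻¹ := by
    rw [eq_inv_iff_mul_eq_one, mul_eq_one_comm, ← hinf, hbc]
    simp only [pow_two]
    group
  have hc'z : c' = z⁻¹ * c := by
    have hca : c * a = a * b := by rw [← hc]; group
    rw [hprod, hca] at hsymm
    rw [eq_inv_mul_of_mul_eq hsymm, hz3]
    simp only [pow_succ, pow_zero]
    group
  have ha' : a' = a := by
    have : a' = c⁻¹ * (a * b) := by
      rw [eq_inv_mul_of_mul_eq hprod, hc'z, hz3]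
      group
    rw [this, inv_mul_eq_iff_eq_mul, ← hc]
    group
  have hz1 : z = 1 := by
    rw [hc'z] at hc'
    have h₁ : z⁻¹ * c * b * (z⁻¹ * c) = z⁻¹ * (z⁻¹ * (c * b * c)) := by
      have := (hzc.mul_right hzb).inv_left.eq
      calc z⁻¹ * c * b * (z⁻¹ * c) = z⁻¹ * ((c * b) * z⁻¹) * c := by group
        _ = _ := by rw [← this]; group
    have h₂ : b * (z⁻¹ * c) * b = z⁻¹ * (b * c * b) := by
      rw [← mul_assoc, ← hzb.inv_left.eq]
      group
    rw [h₁, h₂, hcbc] at hc'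
    simpa using hc'
  exact ⟨ha', by rw [hc'z, hz1]; simp, by rw [pow_two, ← hz, hz1]⟩

end Braid

section PresentedQuotient

variable {ι : Type*} {rels : Set (FreeGroup ι)} {w : PresentedGroup rels}
  {G : Type*} [Group G]

/-- The homomorphism out of the quotient of a presented group by one further relator. -/
def liftQuotient (w : PresentedGroup rels) (f : ι → G) (h : ∀ r ∈ rels, FreeGroup.lift f r = 1)
    (hw : PresentedGroup.toGroup h w = 1) :
    PresentedGroup rels ⧸ Subgroup.normalClosure ({w} : Set (PresentedGroup rels)) →* G :=
  QuotientGroup.lift _ (PresentedGroup.toGroup h) <| by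
    have : Subgroup.normalClosure {w} ≤ (PresentedGroup.toGroup h).ker :=
      Subgroup.normalClosure_le_normal (by simpa [MonoidHom.mem_ker] using hw)
    exact fun x hx ↦ this hx

@[simp]
lemma liftQuotient_of (f : ι → G) (h : ∀ r ∈ rels, FreeGroup.lift f r = 1)
    (hw : PresentedGroup.toGroup h w = 1) (i : ι) :
    liftQuotient w f h hw (QuotientGroup.mk (PresentedGroup.of i)) = f i :=
  PresentedGroup.toGroup.of h

lemma hom_ext_quotient
    {f g : PresentedGroup rels ⧸ Subgroup.normalClosure ({w} : Set (PresentedGroup rels)) →* G}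
    (h : ∀ i, f (QuotientGroup.mk (PresentedGroup.of i)) =
      g (QuotientGroup.mk (PresentedGroup.of i))) : f = g :=
  QuotientGroup.monoidHom_ext _ (PresentedGroup.ext h)

lemma lift_quotient_eq_one {r : FreeGroup ι} (hr : r ∈ rels) :
    FreeGroup.lift (fun i ↦ (QuotientGroup.mk (PresentedGroup.of i) :
      PresentedGroup rels ⧸ Subgroup.normalClosure ({w} : Set (PresentedGroup rels)))) r = 1 := by
  have : FreeGroup.lift (fun i ↦ (QuotientGroup.mk (PresentedGroup.of i) :
      PresentedGroup rels ⧸ Subgroup.normalClosure ({w} : Set (PresentedGroup rels)))) =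
      (QuotientGroup.mk' _).comp (PresentedGroup.mk rels) := by
    ext i
    simp [PresentedGroup.of]
  rw [this, MonoidHom.comp_apply, PresentedGroup.one_of_mem hr, map_one]

lemma mk_relator_eq_one {v : PresentedGroup rels} (hv : v = w) :
    (QuotientGroup.mk v :
      PresentedGroup rels ⧸ Subgroup.normalClosure ({w} : Set (PresentedGroup rels))) = 1 :=
  (QuotientGroup.eq_one_iff _).mpr (Subgroup.subset_normalClosure hv)

end PresentedQuotient

lemma q_braid : q1 * q2 * q1 = q2 * q1 * q2 := by
  have := lift_quotient_eq_one (w := (σ1 * σ2 * σ1) ^ 2) (rels := relsB3) rfl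
  simp only [map_mul, map_inv, FreeGroup.lift_apply_of, mul_inv_eq_one] at this
  exact this

lemma q_sq : (q1 * q2 * q1) ^ 2 = 1 := mk_relator_eq_one rfl

section LiftQ3

variable {G : Type*} [Group G]

/-- The universal property of `B₃/⟪(σ₁σ₂σ₁)²⟫`. -/
def liftQ3 (x y : G) (h : x * y * x = y * x * y) (hsq : (x * y * x) ^ 2 = 1) : Q3 →* G :=
  liftQuotient _ ![x, y] (by
    rintro r rfl
    simp only [map_mul, map_inv, FreeGroup.lift_apply_of, mul_inv_eq_one]
    exact h) (by
    simpa [σ1, σ2] using hsq)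

@[simp]
lemma liftQ3_q1 (x y : G) (h : x * y * x = y * x * y) (hsq : (x * y * x) ^ 2 = 1) :
    liftQ3 x y h hsq q1 = x :=
  liftQuotient_of _ _ _ 0

@[simp]
lemma liftQ3_q2 (x y : G) (h : x * y * x = y * x * y) (hsq : (x * y * x) ^ 2 = 1) :
    liftQ3 x y h hsq q2 = y :=
  liftQuotient_of _ _ _ 1

lemma Q3.hom_ext {f g : Q3 →* G} (h₁ : f q1 = g q1) (h₂ : f q2 = g q2) : f = g :=
  hom_ext_quotient fun i ↦ by
    fin_cases i
    exacts [h₁, h₂]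

end LiftQ3

lemma exists_mulEquiv_Q3 {ι : Type*} {rels : Set (FreeGroup ι)} {w : PresentedGroup rels}
    (f : ι → Q3) (h : ∀ r ∈ rels, FreeGroup.lift f r = 1) (hw : PresentedGroup.toGroup h w = 1)
    (i j : ι) (hi : f i = q1) (hj : f j = q2)
    (g : Q3 →* PresentedGroup rels ⧸ Subgroup.normalClosure ({w} : Set (PresentedGroup rels)))
    (hg₁ : g q1 = QuotientGroup.mk (PresentedGroup.of i))
    (hg₂ : g q2 = QuotientGroup.mk (PresentedGroup.of j))
    (hg : ∀ k, g (f k) = QuotientGroup.mk (PresentedGroup.of k)) :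
    ∃ e : (PresentedGroup rels ⧸ Subgroup.normalClosure ({w} : Set (PresentedGroup rels))) ≃* Q3,
      ∀ k, e (QuotientGroup.mk (PresentedGroup.of k)) = f k :=
  ⟨MonoidHom.toMulEquiv (liftQuotient w f h hw) g
    (hom_ext_quotient fun k ↦ by simp [hg])
    (Q3.hom_ext (by simp [hg₁, hi]) (by simp [hg₂, hj])), fun k ↦ by simp⟩

lemma q_conj : q1 * q2 * q1⁻¹ = q2⁻¹ * q1 * q2 := conj_eq_of_braid q_braid

lemma q_sq_conj : (q1 * q2 * (q2⁻¹ * q1 * q2)) ^ 2 = 1 := by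
  have : (q1 * q2 * (q2⁻¹ * q1 * q2)) ^ 2 = q1 * (q1 * q2 * q1) ^ 2 * q1⁻¹ := by
    simp only [pow_two]
    group
  rw [this, q_sq]
  group

lemma exists_mulEquiv_G0 {w : G0}
    (hw : (∀ f : G0 →* Q3, f a0 = q1 → f b0 = q2 → f c0 = q2⁻¹ * q1 * q2 → f w = 1))
    (hc : (QuotientGroup.mk c0 : G0 ⧸ Subgroup.normalClosure ({w} : Set G0)) =
      QuotientGroup.mk (a0 * b0 * a0⁻¹)) :
    ∃ e : (G0 ⧸ Subgroup.normalClosure ({w} : Set G0)) ≃* Q3,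
      e (QuotientGroup.mk a0) = q1 ∧ e (QuotientGroup.mk b0) = q2 ∧
      e (QuotientGroup.mk c0) = QuotientGroup.mk (σ2⁻¹ * σ1 * σ2) := by
  have hrel {r : FreeGroup (Fin 3)} (hr : r ∈ rels0) := lift_quotient_eq_one (w := w) hr
  have h := hrel (.inl rfl)
  have hsq := hrel (.inr (.inr (.inr rfl)))
  simp only [map_mul, map_inv, map_pow, FreeGroup.lift_apply_of, mul_inv_eq_one] at h hsq
  have hc' := hc.trans (conj_eq_of_braid h)
  change QuotientGroup.mk (PresentedGroup.of 2) = _ at hc'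
  rw [hc'] at hsq
  have hb := q_braid
  have hbl := braid_conj_left hb
  have hbr := braid_conj_right hb
  rw [q_conj] at hbl hbr
  obtain ⟨e, he⟩ := exists_mulEquiv_Q3 (w := w) ![q1, q2, q2⁻¹ * q1 * q2]
    (by
      rintro r (rfl | rfl | rfl | rfl) <;>
        simp only [map_mul, map_inv, map_pow, FreeGroup.lift_apply_of, mul_inv_eq_one]
      exacts [hb, hbr, hbl.symm, q_sq_conj])
    (hw _ (by simp [a0]) (by simp [b0]) (by simp [c0]))
    0 1 rfl rfl (liftQ3 _ _ h (braid_sq_of_conj hsq)) (by simp) (by simp)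
    (by
      intro k
      fin_cases k
      · simp
      · simp
      · simpa using hc'.symm)
  exact ⟨e, he 0, he 1, he 2⟩

/-- Let `G` be a quotient of `G̃` in which `γαγ̄ = γ̄ᾱγ` and all of whose relators hold in
`B₃/⟪(σ₁σ₂σ₁)²⟫`. Then `G/⟪β₁γ₁⁻¹⟫` is isomorphic to that group. -/
lemma exists_mulEquiv_of_relsT {rels : Set F5} (hT : relsT ⊆ rels)
    (hsymm : fc * fa * fc' * (fc' * fa' * fc)⁻¹ ∈ rels)
    (h : ∀ r ∈ rels, FreeGroup.lift ![q1, q1, q2, q2⁻¹ * q1 * q2, q2⁻¹ * q1 * q2] r = 1)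
    {w : PresentedGroup rels}
    (hw : w = .of 0 * .of 2 * (.of 0)⁻¹ * (.of 3)⁻¹) :
    ∃ e : (PresentedGroup rels ⧸ Subgroup.normalClosure ({w} : Set (PresentedGroup rels))) ≃* Q3,
      ∀ k, e (QuotientGroup.mk (PresentedGroup.of k)) =
        ![q1, q1, q2, q2⁻¹ * q1 * q2, q2⁻¹ * q1 * q2] k := by
  have hrel {r : F5} (hr : r ∈ rels) := lift_quotient_eq_one (w := w) hr
  have hab := hrel (hT (.inl rfl))
  have hbc := hrel (hT (.inr (.inr (.inr (.inl rfl)))))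
  have hinf := hrel (hT (.inr (.inr (.inr (.inr rfl)))))
  have hs := hrel hsymm
  simp only [fa, fa', fb, fc, fc', map_mul, map_inv, FreeGroup.lift_apply_of, mul_inv_eq_one]
    at hab hbc hinf hs
  have hc := mk_relator_eq_one hw.symm
  simp only [QuotientGroup.mk_mul, QuotientGroup.mk_inv, mul_inv_eq_one] at hc
  obtain ⟨ha', hc', hsq⟩ := collapse_of_conj_eq hab hbc hinf hs hc
  have hconj := conj_eq_of_braid hab
  refine exists_mulEquiv_Q3 (w := w) _ h ?_ 0 2 rfl rfl (liftQ3 _ _ hab hsq) (by simp) (by simp) ?_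
  · simp [hw, q_conj]
  · intro k
    fin_cases k
    · simp
    · simpa using ha'.symm
    · simp
    · simpa [← hconj] using hc
    · simpa [← hconj, hc'] using hc

lemma lift_relsT_eq_one {r : F5} (hr : r ∈ relsT) :
    FreeGroup.lift ![q1, q1, q2, q2⁻¹ * q1 * q2, q2⁻¹ * q1 * q2] r = 1 := by
  have hb := q_braid
  have hbr := braid_conj_right hb
  rw [q_conj] at hbr
  rcases hr with (rfl | rfl | rfl | rfl | rfl) <;>
    simp only [fa, fa', fb, fc, fc', map_mul, map_inv, FreeGroup.lift_apply_of, mul_inv_eq_one]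
  · exact hb
  · exact hb
  · exact hbr.symm
  · exact hbr.symm
  · have := q_sq
    rw [pow_two] at this
    simpa [mul_assoc] using this

lemma lift_rels1_eq_one {r : F5} (hr : r ∈ rels1) :
    FreeGroup.lift ![q1, q1, q2, q2⁻¹ * q1 * q2, q2⁻¹ * q1 * q2] r = 1 := by
  have hbl := braid_conj_left q_braid
  rw [q_conj] at hbl
  rcases hr with hr | (rfl | rfl | rfl | rfl)
  · exact lift_relsT_eq_one hr
  all_goals
    simp only [fa, fa', fc, fc', map_mul, map_inv, FreeGroup.lift_apply_of, mul_inv_eq_one]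
  exacts [hbl, hbl, rfl, rfl]

lemma lift_rels2_eq_one {r : F5} (hr : r ∈ rels2) :
    FreeGroup.lift ![q1, q1, q2, q2⁻¹ * q1 * q2, q2⁻¹ * q1 * q2] r = 1 := by
  have hbl := braid_conj_left q_braid
  rw [q_conj] at hbl
  rcases hr with hr | (rfl | rfl | rfl)
  · exact lift_relsT_eq_one hr
  all_goals
    simp only [fa, fa', fc, fc', map_mul, map_inv, FreeGroup.lift_apply_of, mul_inv_eq_one]
  exacts [rfl, hbl, rfl]

section FreeProduct

variable {G : Type*} [Group G]

/-- The homomorphism from the cyclic group of order `n` sending the generator to `x`. -/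
def cyclicLift (n : ℕ) (x : G) (h : x ^ n = 1) : Multiplicative (ZMod n) →* G :=
  AddMonoidHom.toMultiplicativeLeft
    (ZMod.lift n ⟨zmultiplesHom (Additive G) (Additive.ofMul x), by
      simpa [← ofMul_pow] using h⟩)

@[simp]
lemma cyclicLift_ofAdd_one (n : ℕ) (x : G) (h : x ^ n = 1) :
    cyclicLift n x h (Multiplicative.ofAdd 1) = x := by
  have := ZMod.lift_coe n ⟨zmultiplesHom (Additive G) (Additive.ofMul x), by
      simpa [← ofMul_pow] using h⟩ 1
  simpa [cyclicLift] using congrArg Additive.toMul this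

lemma cyclic_hom_ext {n : ℕ} {f g : Multiplicative (ZMod n) →* G}
    (h : f (Multiplicative.ofAdd 1) = g (Multiplicative.ofAdd 1)) : f = g := by
  refine MonoidHom.ext fun x ↦ ?_
  obtain ⟨k, hk⟩ := ZMod.intCast_surjective (Multiplicative.toAdd x)
  have : x = Multiplicative.ofAdd (1 : ZMod n) ^ k := by
    rw [← ofAdd_zsmul, zsmul_one, hk, ofAdd_toAdd]
  rw [this, map_zpow, map_zpow, h]

end FreeProduct

theorem nonempty_Q3_mulEquiv_coprod :
    Nonempty (Q3 ≃* Monoid.Coprod (Multiplicative (ZMod 2)) (Multiplicative (ZMod 3))) := by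
  let x : Monoid.Coprod (Multiplicative (ZMod 2)) (Multiplicative (ZMod 3)) :=
    Monoid.Coprod.inl (Multiplicative.ofAdd 1)
  let y : Monoid.Coprod (Multiplicative (ZMod 2)) (Multiplicative (ZMod 3)) :=
    Monoid.Coprod.inr (Multiplicative.ofAdd 1)
  have hx : x ^ 2 = 1 := by
    rw [← map_pow, ← ofAdd_nsmul]
    exact map_one _
  have hy : y ^ 3 = 1 := by
    rw [← map_pow, ← ofAdd_nsmul]
    exact map_one _
  have hxyx : y⁻¹ * x * (x⁻¹ * y ^ 2) * (y⁻¹ * x) = x := by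
    group
  have hyxy : x⁻¹ * y ^ 2 * (y⁻¹ * x) * (x⁻¹ * y ^ 2) = x := by
    have h₁ : x⁻¹ * y ^ 2 * (y⁻¹ * x) * (x⁻¹ * y ^ 2) = x⁻¹ * y ^ 3 := by group
    have h₂ : x⁻¹ = x := inv_eq_of_mul_eq_one_left (by rw [← pow_two, hx])
    rw [h₁, hy, h₂, mul_one]
  have hq : (q1 * q2) ^ 3 = 1 := by
    have : (q1 * q2) ^ 3 = (q1 * q2 * q1) * (q2 * q1 * q2) := by
      simp only [pow_succ, pow_zero, one_mul, mul_assoc]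
    rw [this, ← q_braid, ← pow_two, q_sq]
  refine ⟨MonoidHom.toMulEquiv
    (liftQ3 (y⁻¹ * x) (x⁻¹ * y ^ 2) (hxyx.trans hyxy.symm) (by rw [hxyx, hx]))
    (Monoid.Coprod.lift (cyclicLift 2 (q1 * q2 * q1) q_sq) (cyclicLift 3 (q1 * q2) hq))
    (Q3.hom_ext ?_ ?_) (Monoid.Coprod.hom_ext (cyclic_hom_ext ?_) (cyclic_hom_ext ?_))⟩
  · simp [x, y]
    group
  · simp [x, y, pow_two]
    group
  · simpa using hxyx
  · simp [x, y, pow_two]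

end Sextics

open Sextics

/-- Lemma `A5=` of the paper: with `β₁ = αβα⁻¹` and `γ₁ = γ`, the assignment
`α, ᾱ ↦ σ₁`, `β ↦ σ₂`, `γ, γ̄ ↦ σ₂⁻¹σ₁σ₂` induces isomorphisms
`G₀/⟪[β₁,γ₁]⟫ ≅ B₃/⟪(σ₁σ₂σ₁)²⟫` and `G_m/⟪β₁γ₁⁻¹⟫ ≅ B₃/⟪(σ₁σ₂σ₁)²⟫` for `m ∈ {0,1,2}`;
moreover this group is isomorphic to `ℤ/2 ∗ ℤ/3`. -/
theorem perturbed_A5_equal_groups :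
    (∃ e : (G0 ⧸ Subgroup.normalClosure
          ({(a0 * b0 * a0⁻¹) * c0 * (a0 * b0 * a0⁻¹)⁻¹ * c0⁻¹} : Set G0)) ≃* Q3,
        e (QuotientGroup.mk a0) = q1 ∧ e (QuotientGroup.mk b0) = q2 ∧
        e (QuotientGroup.mk c0) = QuotientGroup.mk (σ2⁻¹ * σ1 * σ2)) ∧
    (∃ e : (G0 ⧸ Subgroup.normalClosure
          ({(a0 * b0 * a0⁻¹) * c0⁻¹} : Set G0)) ≃* Q3,
        e (QuotientGroup.mk a0) = q1 ∧ e (QuotientGroup.mk b0) = q2 ∧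
        e (QuotientGroup.mk c0) = QuotientGroup.mk (σ2⁻¹ * σ1 * σ2)) ∧
    (∃ e : (G1 ⧸ Subgroup.normalClosure
          ({(a1 * b1 * a1⁻¹) * c1⁻¹} : Set G1)) ≃* Q3,
        e (QuotientGroup.mk a1) = q1 ∧ e (QuotientGroup.mk a1') = q1 ∧
        e (QuotientGroup.mk b1) = q2 ∧
        e (QuotientGroup.mk c1) = QuotientGroup.mk (σ2⁻¹ * σ1 * σ2) ∧
        e (QuotientGroup.mk c1') = QuotientGroup.mk (σ2⁻¹ * σ1 * σ2)) ∧
    (∃ e : (G2 ⧸ Subgroup.normalClosure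
          ({(a2 * b2 * a2⁻¹) * c2⁻¹} : Set G2)) ≃* Q3,
        e (QuotientGroup.mk a2) = q1 ∧ e (QuotientGroup.mk a2') = q1 ∧
        e (QuotientGroup.mk b2) = q2 ∧
        e (QuotientGroup.mk c2) = QuotientGroup.mk (σ2⁻¹ * σ1 * σ2) ∧
        e (QuotientGroup.mk c2') = QuotientGroup.mk (σ2⁻¹ * σ1 * σ2)) ∧
    Nonempty (Q3 ≃* Monoid.Coprod (Multiplicative (ZMod 2)) (Multiplicative (ZMod 3))) := by
  refine ⟨exists_mulEquiv_G0 ?_ ?_, exists_mulEquiv_G0 ?_ ?_, ?_, ?_, nonempty_Q3_mulEquiv_coprod⟩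
  · intro f ha hb hc
    simp only [map_mul, map_inv, ha, hb, hc, q_conj]
    group
  · set w := (a0 * b0 * a0⁻¹) * c0 * (a0 * b0 * a0⁻¹)⁻¹ * c0⁻¹ with hw
    have hrel {r : FreeGroup (Fin 3)} (hr : r ∈ rels0) := lift_quotient_eq_one (w := w) hr
    have hab := hrel (.inl rfl)
    have hca := hrel (.inr (.inr (.inl rfl)))
    have hsq := hrel (.inr (.inr (.inr rfl)))
    have hcomm := mk_relator_eq_one hw.symm
    simp only [map_mul, map_inv, map_pow, FreeGroup.lift_apply_of, mul_inv_eq_one]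
      at hab hca hsq
    simp only [QuotientGroup.mk_mul, QuotientGroup.mk_inv, mul_inv_eq_iff_eq_mul, one_mul]
      at hcomm
    refine (eq_of_braid_of_sq_eq_one (braid_conj_left hab).symm hca.symm ?_ ?_).symm
    · simp only [mul_assoc] at hcomm ⊢
      exact hcomm
    · simpa using hsq
  · intro f ha hb hc
    simp only [map_mul, map_inv, ha, hb, hc, q_conj]
    group
  · have := mk_relator_eq_one (rfl : (a0 * b0 * a0⁻¹) * c0⁻¹ = _)
    rw [QuotientGroup.mk_mul, QuotientGroup.mk_inv, mul_inv_eq_one] at this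
    exact this.symm
  · obtain ⟨e, he⟩ := exists_mulEquiv_of_relsT Set.subset_union_left
      (.inr (.inr (.inr (.inl rfl)))) (fun _ ↦ lift_rels1_eq_one)
      (w := (a1 * b1 * a1⁻¹) * c1⁻¹) rfl
    exact ⟨e, he 0, he 1, he 2, he 3, he 4⟩
  · obtain ⟨e, he⟩ := exists_mulEquiv_of_relsT Set.subset_union_left
      (.inr (.inr (.inr rfl))) (fun _ ↦ lift_rels2_eq_one)
      (w := (a2 * b2 * a2⁻¹) * c2⁻¹) rfl
    exact ⟨e, he 0, he 1, he 2, he 3, he 4⟩
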